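/- Let A be a local Cohen–Macaulay ring of Krull dimension d with maximal ideal m. Then the multiplicity satisfies e(A) ≥ emb.dim(A) − d + 1 (Abhyankar's inequality). -/

import Mathlib

/-- The length of a module, as the Krull dimension of its lattice of submodules. -/
noncomputable def moduleLength (A : Type*) [CommRing A] (M : Type*) [AddCommGroup M]
    [Module A M] : WithBot (WithTop ℕ) :=
  Order.krullDim (Submodule A M)

/-- `e` is the Hilbert–Samuel multiplicity of the `d`-dimensional local ring `(A, m)`:
there is a polynomial `p` of degree `d` with leading coefficient `e/d!` whose values
eventually agree with `length (A/mⁿ)`. -/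
def IsHSMultiplicity (A : Type*) [CommRing A] [IsLocalRing A] (d : ℕ) (e : ℕ) : Prop :=
  ∃ p : Polynomial ℚ, p.natDegree = d ∧ p.coeff d * (d.factorial : ℚ) = (e : ℚ) ∧
    ∀ᶠ n : ℕ in Filter.atTop, ∃ m : ℕ, (m : ℚ) = p.eval (n : ℚ) ∧
      moduleLength A (A ⧸ (IsLocalRing.maximalIdeal A ^ n)) = (m : WithBot (WithTop ℕ))

section

open IsLocalRing Filter

/-- A module over a local ring with infinite residue field is not a finite union of proper
submodules. -/
theorem IsLocalRing.exists_forall_notMem_of_top_notMem {A M : Type*} [CommRing A] [IsLocalRing A]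
    [Infinite (ResidueField A)] [AddCommGroup M] [Module A M] (s : Finset (Submodule A M))
    (hs : ⊤ ∉ s) : ∃ x : M, ∀ N ∈ s, x ∉ N := by
  by_contra! h
  obtain ⟨N, hN, hfi⟩ := Submodule.exists_finiteIndex_of_cover (p := id) (s := s)
    (Set.eq_univ_of_forall fun x ↦ by simpa using h x)
  have : N.toAddSubgroup.FiniteIndex := hfi
  have : Finite (M ⧸ N) := AddSubgroup.finite_quotient_of_finiteIndex (H := N.toAddSubgroup)
  obtain ⟨v, hv⟩ : ∃ v, v ∉ N := by
    by_contra! hv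
    exact hs ((Submodule.eq_top_iff'.2 hv) ▸ hN)
  let f : A →ₗ[A] M ⧸ N := LinearMap.toSpanSingleton A _ (N.mkQ v)
  have hker : LinearMap.ker f ≤ maximalIdeal A := by
    refine le_maximalIdeal fun h ↦ hv ?_
    have : f 1 = 0 := by rw [← LinearMap.mem_ker, h]; trivial
    simpa [f] using this
  have : Finite (A ⧸ LinearMap.ker f) := Finite.of_injective _ f.quotKerEquivRange.injective
  have : Finite (ResidueField A) :=
    Finite.of_surjective _ (Ideal.Quotient.factor_surjective hker)
  exact not_finite (ResidueField A)

namespace reesAlgebra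

variable {A : Type*} [CommRing A] {I : Ideal A}

/-- The inclusion of the degree one part of the Rees algebra. -/
noncomputable def degreeOne (I : Ideal A) : I →ₗ[A] reesAlgebra I where
  toFun x := ⟨Polynomial.monomial 1 (x : A), reesAlgebra.monomial_mem.2 (by simp)⟩
  map_add' x y := by ext1; simp
  map_smul' a x := by ext1; simp [Polynomial.smul_monomial]

theorem exists_monomial_mem_pow {n : ℕ} {y : A} (hy : y ∈ I ^ n) :
    ∃ h : Polynomial.monomial n y ∈ reesAlgebra I,
      (⟨_, h⟩ : reesAlgebra I) ∈ Ideal.span (Set.range (degreeOne I)) ^ n := by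
  induction n generalizing y with
  | zero => exact ⟨reesAlgebra.monomial_mem.2 hy, by simp⟩
  | succ n ih =>
    rw [pow_succ] at hy
    induction hy using Submodule.mul_induction_on' with
    | mem_mul_mem a ha b hb =>
      obtain ⟨h, h'⟩ := ih ha
      refine ⟨reesAlgebra.monomial_mem.2 (by rw [pow_succ]; exact Ideal.mul_mem_mul ha hb), ?_⟩
      rw [pow_succ (Ideal.span _)]
      convert Ideal.mul_mem_mul h' (Ideal.subset_span (Set.mem_range_self (f := degreeOne I) ⟨b, hb⟩)) using 1
      ext1
      simp [degreeOne, Polynomial.monomial_mul_monomial]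
    | add a ha b hb iha ihb =>
      obtain ⟨h1, h1'⟩ := iha
      obtain ⟨h2, h2'⟩ := ihb
      refine ⟨by rw [map_add]; exact add_mem h1 h2, ?_⟩
      convert add_mem h1' h2' using 1
      ext1
      simp

theorem monomial_mem_map {n : ℕ} {y : A} (hy : y ∈ I ^ (n + 1)) :
    ∃ h : Polynomial.monomial n y ∈ reesAlgebra I,
      (⟨_, h⟩ : reesAlgebra I) ∈ I.map (algebraMap A (reesAlgebra I)) := by
  rw [pow_succ'] at hy
  induction hy using Submodule.mul_induction_on' with
  | mem_mul_mem a ha b hb =>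
    refine ⟨reesAlgebra.monomial_mem.2 (Ideal.mul_mem_left _ _ hb), ?_⟩
    convert Ideal.mul_mem_right (⟨_, reesAlgebra.monomial_mem.2 hb⟩ : reesAlgebra I) _
      (Ideal.mem_map_of_mem (algebraMap A (reesAlgebra I)) ha) using 1
    ext1
    simp [Polynomial.C_mul_monomial]
  | add a ha b hb iha ihb =>
    obtain ⟨h1, h1'⟩ := iha
    obtain ⟨h2, h2'⟩ := ihb
    refine ⟨by rw [map_add]; exact add_mem h1 h2, ?_⟩
    convert add_mem h1' h2' using 1
    ext1
    simp

theorem coeff_mem_of_mem_map {f : reesAlgebra I}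
    (hf : f ∈ I.map (algebraMap A (reesAlgebra I))) (n : ℕ) :
    (f : Polynomial A).coeff n ∈ I ^ (n + 1) := by
  induction hf using Submodule.span_induction generalizing n with
  | mem f hf =>
    obtain ⟨a, ha, rfl⟩ := hf
    rcases n with _ | n
    · simpa using ha
    · simp
  | zero => simp
  | add f g _ _ hf hg => simpa using add_mem (hf n) (hg n)
  | smul r f _ hf =>
    simp only [smul_eq_mul, MulMemClass.coe_mul, Polynomial.coeff_mul]
    refine sum_mem fun p hp ↦ ?_
    rw [← Finset.HasAntidiagonal.mem_antidiagonal.1 hp, add_assoc, pow_add]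
    exact Ideal.mul_mem_mul (r.2 _) (hf _)

end reesAlgebra

/-- Over a local ring with infinite residue field, there are elements of any ideal outside
of finitely many proper submodules, whose initial forms of degree one have annihilators of bounded
degree in the associated graded ring. -/
theorem IsLocalRing.exists_superficial {A : Type*} [CommRing A] [IsLocalRing A] [IsNoetherianRing A]
    [Infinite (ResidueField A)] (m : Ideal A) (s : Finset (Submodule A m)) (hs : ⊤ ∉ s) :
    ∃ x : m, (∀ N ∈ s, x ∉ N) ∧ ∃ c : ℕ, ∀ n ≥ c, ∀ y ∈ m ^ n,
      (x : A) * y ∈ m ^ (n + 2) → y ∈ m ^ (n + 1) := by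
  classical
  obtain ⟨t, ht, htp⟩ := Submodule.isLasker (reesAlgebra m) (reesAlgebra m)
    (m.map (algebraMap A (reesAlgebra m)))
  let V : Ideal (reesAlgebra m) → Submodule A m := fun Q ↦
    (Q.radical.restrictScalars A).comap (reesAlgebra.degreeOne m)
  obtain ⟨x, hx⟩ := exists_forall_notMem_of_top_notMem (s ∪ (t.image V).erase ⊤) (by simp [hs])
  have key : ∀ Q ∈ t, ∃ c : ℕ, ∀ n ≥ c, ∀ y ∈ m ^ n, (x : A) * y ∈ m ^ (n + 2) →
      ∃ h : Polynomial.monomial n y ∈ reesAlgebra m, (⟨_, h⟩ : reesAlgebra m) ∈ Q := by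
    intro Q hQ
    by_cases hV : V Q = ⊤
    · have hle : Ideal.span (Set.range (reesAlgebra.degreeOne m)) ≤ Ideal.radical Q := by
        rw [Ideal.span_le]
        rintro _ ⟨z, rfl⟩
        have : z ∈ V Q := hV ▸ trivial
        exact this
      obtain ⟨c, hc⟩ := Ideal.exists_pow_le_of_le_radical_of_fg hle (IsNoetherian.noetherian _)
      refine ⟨c, fun n hn y hy _ ↦ ?_⟩
      obtain ⟨h, h'⟩ := reesAlgebra.exists_monomial_mem_pow hy
      exact ⟨h, hc (Ideal.pow_le_pow_right hn h')⟩
    · refine ⟨0, fun n _ y hy hxy ↦ ⟨reesAlgebra.monomial_mem.2 hy, ?_⟩⟩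
      have hxV : x ∉ V Q := hx _ (by simp [hV]; exact Or.inr ⟨Q, hQ, rfl⟩)
      obtain ⟨h, h'⟩ := reesAlgebra.monomial_mem_map (n := n + 1) hxy
      have hmem : (reesAlgebra.degreeOne m x) • (⟨_, reesAlgebra.monomial_mem.2 hy⟩ :
          reesAlgebra m) ∈ Q := by
        have hle : m.map (algebraMap A (reesAlgebra m)) ≤ Q := by
          rw [← ht]; exact Finset.inf_le hQ
        convert hle h' using 1
        ext1
        simp [reesAlgebra.degreeOne, Polynomial.monomial_mul_monomial, add_comm]
      refine ((htp hQ).mem_or_mem hmem).resolve_right fun hr ↦ hxV ?_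
      have : reesAlgebra.degreeOne m x ∈ Ideal.radical Q := by simpa using hr
      exact this
  choose! c hc using key
  refine ⟨x, fun N hN ↦ hx N (by simp [hN]), t.sup c, fun n hn y hy hxy ↦ ?_⟩
  have hmem : (⟨_, reesAlgebra.monomial_mem.2 hy⟩ : reesAlgebra m) ∈
      m.map (algebraMap A (reesAlgebra m)) := by
    rw [← ht, Submodule.mem_finsetInf]
    exact fun Q hQ ↦ (hc Q hQ n ((Finset.le_sup hQ).trans hn) y hy hxy).2
  simpa using reesAlgebra.coeff_mem_of_mem_map hmem n

/-- If `x` is regular and superficial, then multiplication by `x` detects large powers of `I`. -/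
theorem Ideal.exists_forall_mem_pow_of_mul_mem {A : Type*} [CommRing A] [IsNoetherianRing A]
    {I : Ideal A} {x : A} (hreg : IsSMulRegular A x) {c : ℕ}
    (hc : ∀ n ≥ c, ∀ y ∈ I ^ n, x * y ∈ I ^ (n + 2) → y ∈ I ^ (n + 1)) :
    ∃ n₀ : ℕ, ∀ n ≥ n₀, ∀ y, x * y ∈ I ^ (n + 1) → y ∈ I ^ n := by
  obtain ⟨k, hk⟩ := Ideal.exists_pow_inf_eq_pow_smul I (Ideal.span {x})
  refine ⟨c + k, fun n hn y hxy ↦ ?_⟩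
  have hyc : y ∈ I ^ c := by
    have h1 : x * y ∈ (I ^ (n + 1) • ⊤ ⊓ Ideal.span {x} : Ideal A) :=
      ⟨by simpa using hxy, Ideal.mul_mem_right _ _ (Ideal.mem_span_singleton_self x)⟩
    rw [hk (n + 1) (by omega)] at h1
    have h2 : x * y ∈ I ^ (n + 1 - k) * Ideal.span {x} :=
      Submodule.smul_mono le_rfl inf_le_right h1
    obtain ⟨z, hz, hzy⟩ := Ideal.mem_mul_span_singleton.1 h2
    have : z = y := hreg (by simpa [mul_comm] using hzy)
    exact Ideal.pow_le_pow_right (by omega) (this ▸ hz)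
  have : ∀ j, c + j ≤ n → y ∈ I ^ (c + j) := by
    intro j
    induction j with
    | zero => exact fun _ ↦ hyc
    | succ j ih =>
      intro hj
      exact hc (c + j) (by omega) y (ih (by omega)) (Ideal.pow_le_pow_right (by omega) hxy)
  simpa [show c + (n - c) = n by omega] using this (n - c) (by omega)

section Quotient

variable {A : Type*} [CommRing A] (I : Ideal A) (x : A) (n : ℕ)

/-- The map `A ⧸ Iⁿ → A ⧸ Iⁿ⁺¹` given by multiplication with an element of `I` together with the
projection to `A' ⧸ (I A')ⁿ⁺¹`, where `A' = A ⧸ (x)`. -/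
theorem Ideal.exists_exact_pow_succ_quotient (hx : x ∈ I) :
    ∃ (f : (A ⧸ I ^ n) →ₗ[A] A ⧸ I ^ (n + 1))
      (g : (A ⧸ I ^ (n + 1)) →ₗ[A] (A ⧸ Ideal.span {x}) ⧸
        I.map (Ideal.Quotient.mk (Ideal.span {x})) ^ (n + 1)),
      Function.Exact f g ∧ Function.Surjective g ∧
        ((∀ y, x * y ∈ I ^ (n + 1) → y ∈ I ^ n) → Function.Injective f) := by
  set J := I.map (Ideal.Quotient.mk (Ideal.span {x})) ^ (n + 1) with hJ
  let f : (A ⧸ I ^ n) →ₗ[A] A ⧸ I ^ (n + 1) :=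
    Submodule.mapQ _ _ (LinearMap.mulLeft A x) fun y hy ↦ by
      rw [pow_succ']; exact Ideal.mul_mem_mul hx hy
  let g : (A ⧸ I ^ (n + 1)) →ₗ[A] (A ⧸ Ideal.span {x}) ⧸ J :=
    Submodule.liftQ _ (Algebra.linearMap A ((A ⧸ Ideal.span {x}) ⧸ J)) fun y hy ↦ by
      refine Ideal.Quotient.eq_zero_iff_mem.2 ?_
      rw [hJ, ← Ideal.map_pow]
      exact Ideal.mem_map_of_mem _ hy
  refine ⟨f, g, fun z ↦ ?_, fun z ↦ ?_, fun h ↦ ?_⟩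
  · obtain ⟨y, rfl⟩ := Submodule.mkQ_surjective _ z
    have hg : g (Submodule.mkQ _ y) = 0 ↔ Ideal.Quotient.mk (Ideal.span {x}) y ∈ J :=
      Ideal.Quotient.eq_zero_iff_mem
    rw [hg, hJ, ← Ideal.map_pow, Ideal.mem_map_iff_of_surjective _ Ideal.Quotient.mk_surjective]
    constructor
    · rintro ⟨w, hw, hwy⟩
      obtain ⟨a, ha⟩ := Ideal.mem_span_singleton.1 (Ideal.Quotient.eq.1 hwy.symm)
      refine ⟨Submodule.mkQ _ a, (Submodule.Quotient.eq _).2 ?_⟩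
      simpa [← ha] using hw
    · rintro ⟨w, hw⟩
      obtain ⟨a, rfl⟩ := Submodule.mkQ_surjective _ w
      refine ⟨y - x * a, ?_, ?_⟩
      · exact (Submodule.Quotient.eq _).1 hw.symm
      · rw [Ideal.Quotient.eq]
        exact Ideal.mem_span_singleton.2 ⟨-a, by ring⟩
  · obtain ⟨z, rfl⟩ := Ideal.Quotient.mk_surjective z
    obtain ⟨y, rfl⟩ := Ideal.Quotient.mk_surjective z
    exact ⟨Submodule.mkQ _ y, rfl⟩
  · rw [injective_iff_map_eq_zero]
    intro z hz
    obtain ⟨y, rfl⟩ := Submodule.mkQ_surjective _ z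
    exact (Submodule.Quotient.mk_eq_zero _).2 (h y ((Submodule.Quotient.mk_eq_zero _).1 hz))

theorem Ideal.length_pow_succ_quotient_eq (hx : x ∈ I) (h : ∀ y, x * y ∈ I ^ (n + 1) → y ∈ I ^ n) :
    Module.length A (A ⧸ I ^ (n + 1)) = Module.length A (A ⧸ I ^ n) +
      Module.length (A ⧸ Ideal.span {x}) ((A ⧸ Ideal.span {x}) ⧸
        I.map (Ideal.Quotient.mk (Ideal.span {x})) ^ (n + 1)) := by
  obtain ⟨f, g, hfg, hg, hf⟩ := Ideal.exists_exact_pow_succ_quotient I x n hx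
  rw [Module.length_eq_add_of_exact f g (hf h) hg hfg,
    Module.length_eq_of_surjective (S := A) (R := A ⧸ Ideal.span {x})
      (M := (A ⧸ Ideal.span {x}) ⧸ I.map (Ideal.Quotient.mk (Ideal.span {x})) ^ (n + 1))
      Ideal.Quotient.mk_surjective]

theorem Ideal.length_pow_succ_quotient_le (hx : x ∈ I) :
    Module.length A (A ⧸ I ^ (n + 1)) ≤ Module.length A (A ⧸ I ^ n) +
      Module.length (A ⧸ Ideal.span {x}) ((A ⧸ Ideal.span {x}) ⧸
        I.map (Ideal.Quotient.mk (Ideal.span {x})) ^ (n + 1)) := by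
  obtain ⟨f, g, hfg, hg, -⟩ := Ideal.exists_exact_pow_succ_quotient I x n hx
  rw [Module.length_eq_add_of_exact (LinearMap.range f).subtype g (Submodule.subtype_injective _)
    hg (by rw [LinearMap.exact_iff] at hfg ⊢; simpa using hfg),
    Module.length_eq_of_surjective (S := A) (R := A ⧸ Ideal.span {x})
      (M := (A ⧸ Ideal.span {x}) ⧸ I.map (Ideal.Quotient.mk (Ideal.span {x})) ^ (n + 1))
      Ideal.Quotient.mk_surjective]
  gcongr
  exact Module.length_le_of_surjective f.rangeRestrict f.surjective_rangeRestrict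

end Quotient

open RingTheory.Sequence in
/-- Let `A` be a Noetherian local ring with infinite residue field and a weakly regular sequence of
length `d` in the maximal ideal. Then one can cut by a regular element such that lengths of
quotients by large powers of the maximal ideal behave additively, and the quotient
has a weakly regular sequence of length `d - 1`. -/
theorem IsLocalRing.exists_regular_superficial {A : Type*} [CommRing A] [IsLocalRing A]
    [IsNoetherianRing A] [Infinite (ResidueField A)] {a : A} {rs : List A}
    (hmem : ∀ r ∈ a :: rs, r ∈ maximalIdeal A) (hreg : IsWeaklyRegular A (a :: rs)) :
    ∃ x ∈ maximalIdeal A,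
      IsWeaklyRegular (A ⧸ Ideal.span {x}) (rs.map (Ideal.Quotient.mk (Ideal.span {x}))) ∧
      ∃ n₀ : ℕ, ∀ n ≥ n₀, ∀ y, x * y ∈ maximalIdeal A ^ (n + 1) → y ∈ maximalIdeal A ^ n := by
  classical
  have hperm : IsWeaklyRegular A (rs ++ [a]) :=
    isWeaklyRegular_of_perm_of_subset_maximalIdeal hreg
      (List.perm_append_singleton a rs).symm hmem
  rw [isWeaklyRegular_append_iff, isWeaklyRegular_singleton_iff] at hperm
  obtain ⟨hrs, ha⟩ := hperm
  set M := A ⧸ (Ideal.ofList rs • ⊤ : Submodule A A)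
  have hfin : (associatedPrimes A M).Finite := associatedPrimes.finite A M
  obtain ⟨⟨x, hx⟩, hxs, c, hc⟩ := exists_superficial (maximalIdeal A)
    (hfin.toFinset.image fun p ↦ Submodule.comap (maximalIdeal A).subtype p) (by
      simp only [Finset.mem_image, Set.Finite.mem_toFinset, not_exists, not_and]
      intro p hp htop
      have hap : a ∈ p := by
        have : (⟨a, hmem a (by simp)⟩ : maximalIdeal A) ∈
          Submodule.comap (maximalIdeal A).subtype p := htop ▸ trivial
        exact this
      have : a ∈ {r : A | IsSMulRegular M r}ᶜ := by
        rw [← biUnion_associatedPrimes_eq_compl_regular]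
        exact Set.mem_biUnion hp hap
      exact this ha)
  have hxM : IsSMulRegular M x := by
    by_contra hcon
    have : x ∈ {r : A | IsSMulRegular M r}ᶜ := hcon
    rw [← biUnion_associatedPrimes_eq_compl_regular] at this
    obtain ⟨p, hp, hxp⟩ := Set.mem_iUnion₂.1 this
    exact hxs _ (Finset.mem_image_of_mem _ (hfin.mem_toFinset.2 hp)) hxp
  have hxreg : IsWeaklyRegular A (x :: rs) := by
    refine isWeaklyRegular_of_perm_of_subset_maximalIdeal (rs := rs ++ [x]) ?_
      (List.perm_append_singleton x rs) ?_
    · rw [isWeaklyRegular_append_iff, isWeaklyRegular_singleton_iff]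
      exact ⟨hrs, hxM⟩
    · intro r hr
      rcases List.mem_append.1 hr with hr | hr
      · exact hmem r (by simp [hr])
      · simpa [List.mem_singleton.1 hr] using hx
  rw [isWeaklyRegular_cons_iff] at hxreg
  refine ⟨x, hx, ?_, Ideal.exists_forall_mem_pow_of_mul_mem hxreg.1 hc⟩
  rw [← Ideal.Quotient.algebraMap_eq, isWeaklyRegular_map_algebraMap_iff]
  refine (LinearEquiv.isWeaklyRegular_congr (Submodule.quotEquivOfEq _ _ ?_) rs).1 hxreg.2
  rw [← Submodule.ideal_span_singleton_smul]
  simp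

open RingTheory.Sequence in
theorem IsLocalRing.length_quotient_sq_le_of_infinite (d : ℕ) {A : Type*} [CommRing A]
    [IsLocalRing A] [IsNoetherianRing A] [Infinite (ResidueField A)] (rs : List A)
    (hlen : rs.length = d) (hmem : ∀ r ∈ rs, r ∈ maximalIdeal A) (hreg : IsWeaklyRegular A rs)
    (h : ℕ → ℚ) (s e : ℕ)
    (hh : ∀ᶠ n in atTop, ∃ k : ℕ, h n = k ∧ Module.length A (A ⧸ maximalIdeal A ^ (n + s)) = k)
    (he : ∀ᶠ n in atTop, (fwdDiff 1)^[d] h n = e) :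
    Module.length A (A ⧸ maximalIdeal A ^ 2) ≤ e + d := by
  induction d generalizing A h s with
  | zero =>
    obtain ⟨n, ⟨k, hk, hlen⟩, hn, hn2⟩ := (hh.and (he.and (eventually_ge_atTop 2))).exists
    have hke : k = e := by
      rw [Function.iterate_zero, id, hk] at hn
      exact_mod_cast hn
    rw [Nat.cast_zero, add_zero, ← hke, ← hlen]
    exact Module.length_le_of_surjective
      (Submodule.factor (Ideal.pow_le_pow_right (by omega))) (Submodule.factor_surjective _)
  | succ d ih =>
    obtain _ | ⟨a, rs⟩ := rs
    · simp at hlen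
    obtain ⟨x, hx, hreg', n₀, hn₀⟩ := exists_regular_superficial hmem hreg
    have : Nontrivial (A ⧸ Ideal.span {x}) := Ideal.Quotient.nontrivial_iff.2
      (ne_top_of_le_ne_top (Ideal.IsPrime.ne_top') ((Ideal.span_singleton_le_iff_mem _).2 hx))
    have : IsLocalRing (A ⧸ Ideal.span {x}) :=
      .of_surjective' (Ideal.Quotient.mk _) Ideal.Quotient.mk_surjective
    have : IsLocalHom (Ideal.Quotient.mk (Ideal.span {x})) :=
      .of_surjective _ Ideal.Quotient.mk_surjective
    have : Infinite (ResidueField (A ⧸ Ideal.span {x})) :=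
      Infinite.of_injective (ResidueField.map (Ideal.Quotient.mk (Ideal.span {x})))
        (RingHom.injective _)
    have hmax : (maximalIdeal A).map (Ideal.Quotient.mk (Ideal.span {x})) =
        maximalIdeal (A ⧸ Ideal.span {x}) :=
      map_maximalIdeal_of_surjective _ Ideal.Quotient.mk_surjective
    have key := ih (rs.map (Ideal.Quotient.mk (Ideal.span {x}))) (by simpa using hlen) (by
        intro r hr
        obtain ⟨r, hr', rfl⟩ := List.mem_map.1 hr
        rw [← hmax]
        exact Ideal.mem_map_of_mem _ (hmem r (List.mem_cons_of_mem _ hr'))) hreg' (fwdDiff 1 h) (s + 1) (by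
        filter_upwards [hh, (tendsto_add_atTop_nat 1).eventually hh, eventually_ge_atTop n₀]
          with n ⟨k, hk, hk'⟩ ⟨l, hl, hl'⟩ hn
        have hadd := Ideal.length_pow_succ_quotient_eq (maximalIdeal A) x (n + s) hx
          (hn₀ (n + s) (by omega))
        rw [hmax, hk', show n + s + 1 = n + 1 + s by omega, hl'] at hadd
        rw [show n + (s + 1) = n + 1 + s by omega]
        generalize Module.length (A ⧸ Ideal.span {x}) ((A ⧸ Ideal.span {x}) ⧸
          maximalIdeal (A ⧸ Ideal.span {x}) ^ (n + 1 + s)) = u at hadd ⊢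
        induction u using ENat.recTopCoe with
        | top => simp at hadd
        | coe u =>
          refine ⟨u, ?_, rfl⟩
          rw [fwdDiff, hk, hl, sub_eq_iff_eq_add']
          exact_mod_cast hadd) (by simpa using he)
    refine (Ideal.length_pow_succ_quotient_le (maximalIdeal A) x 1 hx).trans ?_
    rw [hmax, pow_one, Module.length_eq_one_iff.2 (by
      rw [isSimpleModule_iff_quot_maximal]
      exact ⟨_, inferInstance, ⟨LinearEquiv.refl _ _⟩⟩)]
    refine (add_le_add_right key 1).trans ?_
    push_cast
    rw [add_comm, add_assoc]

/-- Every Noetherian local ring has a flat local extension with infinite residue field, along which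
the maximal ideal extends to the maximal ideal. -/
theorem IsLocalRing.exists_flat_extension_infinite_residueField (A : Type*) [CommRing A]
    [IsLocalRing A] [IsNoetherianRing A] :
    ∃ (P : Ideal (Polynomial A)) (_ : P.IsPrime), IsNoetherianRing (Localization.AtPrime P) ∧
      Module.Flat A (Localization.AtPrime P) ∧
      (maximalIdeal A).map (algebraMap A (Localization.AtPrime P)) =
        maximalIdeal (Localization.AtPrime P) ∧
      Infinite (ResidueField (Localization.AtPrime P)) := by
  let P : Ideal (Polynomial A) := (maximalIdeal A).map Polynomial.C
  have hP : P.IsPrime := Ideal.isPrime_map_C_of_isPrime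
  have hflat : Module.Flat (Polynomial A) (Localization.AtPrime P) :=
    IsLocalization.flat _ P.primeCompl
  refine ⟨P, hP, IsLocalization.isNoetherianRing P.primeCompl _ inferInstance,
    Module.Flat.trans A (Polynomial A) _, ?_, ?_⟩
  · rw [← Localization.AtPrime.map_eq_maximalIdeal,
      IsScalarTower.algebraMap_eq A (Polynomial A) (Localization.AtPrime P), ← Ideal.map_map]
    rfl
  · refine Infinite.of_injective (fun i : ℕ ↦ residue (Localization.AtPrime P)
      (algebraMap (Polynomial A) _ (Polynomial.X ^ i))) fun i j hij ↦ ?_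
    by_contra hne
    have hmem : algebraMap (Polynomial A) (Localization.AtPrime P)
        (Polynomial.X ^ i - Polynomial.X ^ j) ∈ maximalIdeal (Localization.AtPrime P) := by
      rw [map_sub]
      exact Ideal.Quotient.eq.1 hij
    rw [IsLocalization.AtPrime.to_map_mem_maximal_iff (Localization.AtPrime P) P,
      Ideal.mem_map_C_iff] at hmem
    have h1 := hmem i
    rw [Polynomial.coeff_sub, Polynomial.coeff_X_pow_self, Polynomial.coeff_X_pow, if_neg hne,
      sub_zero] at h1
    exact (Ideal.ne_top_iff_one _).1 Ideal.IsPrime.ne_top' h1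

open TensorProduct in
theorem IsLocalRing.length_quotient_pow_eq_of_flat (A B : Type*) [CommRing A] [CommRing B]
    [IsLocalRing A] [IsLocalRing B] [Algebra A B] [Module.Flat A B]
    (hmax : (maximalIdeal A).map (algebraMap A B) = maximalIdeal B) (n : ℕ) :
    Module.length B (B ⧸ maximalIdeal B ^ n) = Module.length A (A ⧸ maximalIdeal A ^ n) := by
  have : IsLocalHom (algebraMap A B) := ((local_hom_TFAE (algebraMap A B)).out 0 2).2 hmax.le
  have h1 : Module.length B (B ⧸ maximalIdeal B) = 1 := Module.length_eq_one_iff.2 (by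
    rw [isSimpleModule_iff_quot_maximal]
    exact ⟨_, inferInstance, ⟨LinearEquiv.refl _ _⟩⟩)
  rw [← mul_one (Module.length A _), ← h1, ← hmax, ← IsLocalRing.length_baseChange, ← Ideal.map_pow]
  exact (Algebra.TensorProduct.quotIdealMapEquivTensorQuot B (maximalIdeal A ^ n)).toLinearEquiv.length_eq

/-- The length of `A ⧸ m²` exceeds the embedding dimension. -/
theorem IsLocalRing.finrank_cotangentSpace_add_one_le (A : Type*) [CommRing A] [IsLocalRing A]
    [IsNoetherianRing A] :
    (Module.finrank (ResidueField A) (CotangentSpace A) + 1 : ℕ∞) ≤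
      Module.length A (A ⧸ maximalIdeal A ^ 2) := by
  rw [← Module.length_eq_finrank, ← Module.length_eq_of_surjective (S := A)
    (M := CotangentSpace A) (R := ResidueField A) residue_surjective]
  have hex := Module.length_eq_add_of_exact (maximalIdeal A).cotangentToQuotientSquare
    (LinearMap.range (maximalIdeal A).cotangentToQuotientSquare).mkQ
    (maximalIdeal A).cotangentToQuotientSquare_injective (Submodule.mkQ_surjective _)
    (LinearMap.exact_map_mkQ_range _)
  rw [hex]
  gcongr
  rw [Order.one_le_iff_ne_zero, Ne, Module.length_eq_zero_iff, Submodule.Quotient.subsingleton_iff]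
  intro htop
  have h1 : (Ideal.Quotient.mk (maximalIdeal A ^ 2) 1) ∈
    LinearMap.range (maximalIdeal A).cotangentToQuotientSquare := htop ▸ trivial
  obtain ⟨z, hz⟩ := h1
  obtain ⟨y, rfl⟩ := Ideal.toCotangent_surjective _ z
  rw [Ideal.toCotangent_to_quotient_square] at hz
  have h2 : (y : A) - 1 ∈ maximalIdeal A ^ 2 := Ideal.Quotient.eq.1 hz
  have h3 : (1 : A) ∈ maximalIdeal A := by
    simpa using sub_mem y.2 (Ideal.pow_le_self two_ne_zero h2)
  exact (Ideal.ne_top_iff_one _).1 Ideal.IsPrime.ne_top' h3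

theorem fwdDiff_iter_comp_natCast (f : ℚ → ℚ) (d n : ℕ) :
    (fwdDiff 1)^[d] (fun n : ℕ ↦ f n) n = (fwdDiff 1)^[d] f n := by
  induction d generalizing f with
  | zero => rfl
  | succ d ih =>
    have h : fwdDiff 1 (fun n : ℕ ↦ f n) = fun n : ℕ ↦ fwdDiff 1 f n := by
      ext k
      simp [fwdDiff]
    rw [Function.iterate_succ_apply, Function.iterate_succ_apply, h, ih]

end

/-- Abhyankar's inequality: for a local Cohen–Macaulay ring `A` of Krull dimension `d`
(Cohen–Macaulayness expressed by the existence of a system of parameters that is a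
regular sequence), the multiplicity satisfies `e(A) ≥ emb.dim(A) − d + 1`. -/
theorem stmt18 (A : Type*) [CommRing A] [IsLocalRing A] [IsNoetherianRing A]
    (d : ℕ) (hd : ringKrullDim A = d)
    (hCM : ∃ rs : List A, rs.length = d ∧ (∀ r ∈ rs, r ∈ IsLocalRing.maximalIdeal A) ∧
      RingTheory.Sequence.IsRegular A rs ∧
      (Ideal.span {r | r ∈ rs}).radical = IsLocalRing.maximalIdeal A)
    (e : ℕ) (he : IsHSMultiplicity A d e) :
    (Module.finrank (IsLocalRing.ResidueField A) (IsLocalRing.CotangentSpace A) : ℤ)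
      - d + 1 ≤ (e : ℤ) := by
  obtain ⟨rs, hlen, hmem, hreg, -⟩ := hCM
  obtain ⟨p, hpd, hpe, hp⟩ := he
  obtain ⟨P, hP, hnoeth, hflat, hmax, hinf⟩ :=
    IsLocalRing.exists_flat_extension_infinite_residueField A
  have hB := IsLocalRing.length_quotient_pow_eq_of_flat A (Localization.AtPrime P) hmax
  have key := IsLocalRing.length_quotient_sq_le_of_infinite d
    (rs.map (algebraMap A (Localization.AtPrime P))) (by simpa using hlen)
    (by
      intro r hr
      obtain ⟨a, ha, rfl⟩ := List.mem_map.1 hr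
      rw [← hmax]
      exact Ideal.mem_map_of_mem _ (hmem a ha))
    hreg.toIsWeaklyRegular.of_flat (fun n ↦ p.eval (n : ℚ)) 0 e
    (by
      filter_upwards [hp] with n ⟨m, hm, hm'⟩
      refine ⟨m, hm.symm, ?_⟩
      rw [add_zero, hB]
      rw [moduleLength, ← Module.coe_length] at hm'
      exact WithBot.coe_injective hm')
    (.of_forall fun n ↦ by
      rw [fwdDiff_iter_comp_natCast (fun x ↦ p.eval x), ← hpd,
        Polynomial.fwdDiff_iter_degree_eq_factorial]
      simpa [hpd, Polynomial.leadingCoeff] using hpe)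
  rw [hB] at key
  have hle : Module.finrank (IsLocalRing.ResidueField A) (IsLocalRing.CotangentSpace A) + 1 ≤
      e + d := by
    exact_mod_cast (IsLocalRing.finrank_cotangentSpace_add_one_le A).trans key
  omega
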